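/- arXiv:math/0309015 — 8 statements merged into one kernel-verified Lean document; each statement's English description precedes it below -/
import Mathlib

section
/- Let v = (a₁,a₂,a₃,a₄,a₅,a₆) ∈ ℝ[Σ₃] be such that F_v is a two-dimensional invariant subspace spanned by v and τ₁₂·v, and F_v is irreducible (its only invariant subspaces are 0 and F_v). Then there exist α, β ∈ ℝ with α² = 1 + β + β² such that a₃ = α a₁ + β a₂, a₄ = −(α a₁ + (1+β) a₂), a₅ = β a₁ + α a₂ and a₆ = −((1+β) a₁ + α a₂), i.e. v = a₁·Id + a₂·τ₁₂ + (αa₁+βa₂)·τ₁₃ − (αa₁+(1+β)a₂)·τ₂₃ + (βa₁+αa₂)·c₁ − ((1+β)a₁+αa₂)·c₂. -/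
open scoped TensorProduct

abbrev S3 := Equiv.Perm (Fin 3)

def t12 : S3 := Equiv.swap 0 1
def t13 : S3 := Equiv.swap 0 2
def t23 : S3 := Equiv.swap 1 2
def c1 : S3 := Equiv.swap 0 2 * Equiv.swap 0 1
def c2 : S3 := c1 * c1

abbrev GA (K : Type*) [Field K] := S3 → K

def act {K : Type*} [Field K] (σ : S3) (v : GA K) : GA K := fun τ => v (σ * τ)

def Fv (K : Type*) [Field K] (v : GA K) : Submodule K (GA K) :=
  Submodule.span K (Set.range fun σ => act σ v)

def elt {K : Type*} [Field K] (a₁ a₂ a₃ a₄ a₅ a₆ : K) : GA K := fun σ =>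
  (if σ = 1 then a₁ else 0) + (if σ = t12 then a₂ else 0) + (if σ = t13 then a₃ else 0) +
  (if σ = t23 then a₄ else 0) + (if σ = c1 then a₅ else 0) + (if σ = c2 then a₆ else 0)

def Vv (K : Type*) [Field K] : GA K := elt 1 (-1) (-1) (-1) 1 1
def Wv (K : Type*) [Field K] : GA K := elt 1 1 1 1 1 1

def assoc {K A : Type*} [Field K] [AddCommGroup A] [Module K A]
    (μ : A →ₗ[K] A →ₗ[K] A) (x y z : A) : A := μ (μ x y) z - μ x (μ y z)

def bra {K A : Type*} [Field K] [AddCommGroup A] [Module K A]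
    (μ : A →ₗ[K] A →ₗ[K] A) (x y : A) : A := μ x y - μ y x

def LieAdmissible {K A : Type*} [Field K] [AddCommGroup A] [Module K A]
    (μ : A →ₗ[K] A →ₗ[K] A) : Prop :=
  ∀ x y z : A, bra μ x (bra μ y z) + bra μ y (bra μ z x) + bra μ z (bra μ x y) = 0

def Lterm {K A : Type*} [Field K] [AddCommGroup A] [Module K A]
    (μ : A →ₗ[K] A →ₗ[K] A) (σ : S3) (x : Fin 3 → A) : A :=
  μ (μ (x (σ⁻¹ 0)) (x (σ⁻¹ 1))) (x (σ⁻¹ 2))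

def Rterm {K A : Type*} [Field K] [AddCommGroup A] [Module K A]
    (μ : A →ₗ[K] A →ₗ[K] A) (σ : S3) (x : Fin 3 → A) : A :=
  μ (x (σ⁻¹ 0)) (μ (x (σ⁻¹ 1)) (x (σ⁻¹ 2)))

def assocPhi {K A : Type*} [Field K] [AddCommGroup A] [Module K A]
    (μ : A →ₗ[K] A →ₗ[K] A) (v : GA K) : Prop :=
  ∀ x : Fin 3 → A, ∑ σ : S3, v σ • assoc μ (x (σ⁻¹ 0)) (x (σ⁻¹ 1)) (x (σ⁻¹ 2)) = 0

theorem act_act {K : Type*} [Field K] (σ ρ : S3) (v : GA K) :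
    act σ (act ρ v) = act (ρ * σ) v := by
  funext τ
  simp [act, mul_assoc]

theorem act_add {K : Type*} [Field K] (σ : S3) (v w : GA K) :
    act σ (v + w) = act σ v + act σ w := rfl

theorem act_smul {K : Type*} [Field K] (σ : S3) (k : K) (v : GA K) :
    act σ (k • v) = k • act σ v := rfl

theorem act_one {K : Type*} [Field K] (v : GA K) : act 1 v = v := by
  funext τ
  simp [act]

theorem act_mem_Fv_self {K : Type*} [Field K] (σ : S3) (v : GA K) : act σ v ∈ Fv K v :=
  Submodule.subset_span ⟨σ, rfl⟩

theorem act_mem_Fv {K : Type*} [Field K] {v x : GA K} (σ : S3) (hx : x ∈ Fv K v) :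
    act σ x ∈ Fv K v := by
  refine Submodule.span_induction ?_ ?_ ?_ ?_ hx
  · rintro _ ⟨ρ, rfl⟩
    rw [act_act]
    exact act_mem_Fv_self _ _
  · exact zero_mem _
  · intro x y _ _ hx hy
    exact add_mem hx hy
  · intro k x _ hx
    exact Submodule.smul_mem _ k hx

theorem c1_mul_t12 : c1 * t12 = t13 := by decide
theorem t12_mul_c1 : t12 * c1 = t23 := by decide
theorem c2_mul_t12 : c2 * t12 = t23 := by decide
theorem c1_mul_c1 : c1 * c1 = c2 := rfl
theorem c2_mul_c1 : c2 * c1 = 1 := by decide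

theorem mul_c1_eq (σ : S3) : σ * c1 = c1 * σ ∨ σ * c1 = c1 * (c1 * σ) := by
  revert σ
  decide

/-- The elements of `Fv K v` fixed by the `3`-cycle `c1`. -/
def fixedByCycle {K : Type*} [Field K] (v : GA K) : Submodule K (GA K) where
  carrier := {x | x ∈ Fv K v ∧ act c1 x = x}
  zero_mem' := ⟨zero_mem _, rfl⟩
  add_mem' := by
    rintro x y ⟨hx, hcx⟩ ⟨hy, hcy⟩
    exact ⟨add_mem hx hy, by rw [act_add, hcx, hcy]⟩
  smul_mem' := by
    rintro k x ⟨hx, hcx⟩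
    exact ⟨Submodule.smul_mem _ k hx, by rw [act_smul, hcx]⟩

theorem act_mem_fixedByCycle {K : Type*} [Field K] {v x : GA K} (σ : S3)
    (hx : x ∈ fixedByCycle v) : act σ x ∈ fixedByCycle v := by
  obtain ⟨hx, hc⟩ := hx
  refine ⟨act_mem_Fv σ hx, ?_⟩
  rw [act_act]
  rcases mul_c1_eq σ with h | h
  · rw [h, ← act_act, hc]
  · rw [h, ← act_act, hc, ← act_act, hc]

theorem perm_cases (σ : S3) :
    (σ = 1 ∧ t12 * σ = t12) ∨ (σ = c1 * 1 ∧ t12 * σ = c1 * (c1 * t12)) ∨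
    (σ = c1 * (c1 * 1) ∧ t12 * σ = c1 * t12) ∨ (σ = t12 ∧ t12 * σ = 1) ∨
    (σ = c1 * t12 ∧ t12 * σ = c1 * (c1 * 1)) ∨ (σ = c1 * (c1 * t12) ∧ t12 * σ = c1 * 1) := by
  revert σ
  decide

theorem act_symmetrized {K : Type*} [Field K] {v : GA K} (hc : act c1 v = v) (σ : S3) :
    act σ (v + act t12 v) = v + act t12 v := by
  have hmul (ρ : S3) : act (c1 * ρ) v = act ρ v := by rw [← act_act, hc]
  rw [act_add, act_act]
  rcases perm_cases σ with h | h | h | h | h | h <;> obtain ⟨h₁, h₂⟩ := h <;> rw [h₂, h₁] <;>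
    simp only [hmul, act_one] <;> exact add_comm _ _

theorem stmt3 (v : GA ℝ)
    (hspan : Fv ℝ v = Submodule.span ℝ ({v, act t12 v} : Set (GA ℝ)))
    (hdim : Module.finrank ℝ (Fv ℝ v) = 2)
    (hirr : ∀ S : Submodule ℝ (GA ℝ), S ≤ Fv ℝ v →
      (∀ (σ : S3) (x : GA ℝ), x ∈ S → act σ x ∈ S) → S = ⊥ ∨ S = Fv ℝ v) :
    ∃ α β : ℝ, α ^ 2 = 1 + β + β ^ 2 ∧
      v t13 = α * v 1 + β * v t12 ∧
      v t23 = -(α * v 1 + (1 + β) * v t12) ∧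
      v c1 = β * v 1 + α * v t12 ∧
      v c2 = -((1 + β) * v 1 + α * v t12) := by
  have hv : v ∈ Fv ℝ v := by simpa only [act_one] using act_mem_Fv_self 1 v
  have hli : LinearIndependent ℝ ![v, act t12 v] := by
    rw [linearIndependent_iff_card_eq_finrank_span, Set.finrank, Matrix.range_cons_cons_empty,
      ← hspan, hdim, Fintype.card_fin]
  have hpair := LinearIndependent.pair_iff.mp hli
  have hsum : v + act c1 v + act c2 v = 0 := by
    rcases hirr (fixedByCycle v) (fun x hx => hx.1)
      (fun σ x hx => act_mem_fixedByCycle σ hx) with h | h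
    · have hmem : v + act c1 v + act c2 v ∈ fixedByCycle v := by
        refine ⟨add_mem (add_mem hv (act_mem_Fv_self _ _)) (act_mem_Fv_self _ _), ?_⟩
        rw [act_add, act_add, act_act, act_act, c1_mul_c1, c2_mul_c1, act_one]
        abel
      rwa [h, Submodule.mem_bot] at hmem
    · exfalso
      have hc : act c1 v = v := (h ▸ hv : v ∈ fixedByCycle v).2
      rcases hirr (Submodule.span ℝ {v + act t12 v})
        ((Submodule.span_singleton_le_iff_mem _ _).mpr (add_mem hv (act_mem_Fv_self _ _)))
        (by
          intro σ x hx
          obtain ⟨k, rfl⟩ := Submodule.mem_span_singleton.mp hx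
          rwa [act_smul, act_symmetrized hc]) with h | h
      · rw [Submodule.span_singleton_eq_bot] at h
        exact one_ne_zero (hpair 1 1 (by simpa using h)).1
      · have := finrank_span_le_card (R := ℝ) ({v + act t12 v} : Set (GA ℝ))
        rw [h, hdim, Set.toFinset_singleton, Finset.card_singleton] at this
        omega
  obtain ⟨β, α, hc1⟩ := Submodule.mem_span_pair.mp (hspan ▸ act_mem_Fv_self c1 v)
  have hc2 : act c2 v = -(1 + β) • v + (-α) • act t12 v := by
    rw [eq_neg_of_add_eq_zero_right hsum, ← hc1]
    module
  have ht13 : act t13 v = β • act t12 v + α • v := by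
    rw [← c1_mul_t12, ← act_act, ← hc1, act_add, act_smul, act_smul, act_act,
      show t12 * t12 = 1 by decide, act_one]
  have ht23 : act t23 v = -(1 + β) • act t12 v + (-α) • v := by
    rw [← c2_mul_t12, ← act_act, hc2, act_add, act_smul, act_smul, act_act,
      show t12 * t12 = 1 by decide, act_one]
  have hsq : act c2 v = β • act c1 v + α • act t23 v := by
    conv_lhs => rw [← c1_mul_c1, ← act_act, ← hc1]
    rw [act_add, act_smul, act_smul, act_act, t12_mul_c1]
  have hrel : β ^ 2 - α ^ 2 + 1 + β = 0 := by
    refine (hpair _ 0 ?_).1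
    rw [hc2, ← hc1, ht23] at hsq
    rw [← sub_eq_zero_of_eq hsq.symm]
    module
  refine ⟨α, β, by linarith, ?_, ?_, ?_, ?_⟩
  · have := congrFun ht13 1
    simp [act] at this
    linarith
  · have := congrFun ht23 1
    simp [act] at this
    linarith
  · have := congrFun hc1 1
    simp [act] at this
    linarith
  · have := congrFun hc2 1
    simp [act] at this
    linarith
end

section
/- Let K be a field of characteristic zero, (A,μ) a K-algebra and v ∈ K[Σ₃], and suppose (A,μ) is a v-algebra in the strong sense that for every w ∈ K[Σ₃] one has A_μ∘Φ_w = 0 if and only if w ∈ F_v. Then (A,μ) is Lie-admissible if and only if V = Id − τ₁₂ − τ₁₃ − τ₂₃ + c₁ + c₂ belongs to F_v. -/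
open scoped TensorProduct

theorem univ_S3 : (Finset.univ : Finset S3) = {1, t12, t13, t23, c1, c2} := by decide

theorem sum_S3 {M : Type*} [AddCommMonoid M] (f : S3 → M) :
    ∑ σ : S3, f σ = f 1 + (f t12 + (f t13 + (f t23 + (f c1 + f c2)))) := by
  rw [univ_S3, Finset.sum_insert (by decide), Finset.sum_insert (by decide),
    Finset.sum_insert (by decide), Finset.sum_insert (by decide), Finset.sum_insert (by decide),
    Finset.sum_singleton]

/-- The value at `σ` of `Vv` is the signature of `σ`. -/
theorem Vv_apply {K : Type*} [Field K] (σ : S3) : Vv K σ = ((Equiv.Perm.sign σ : ℤ) : K) := by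
  have h : ∀ τ : S3, (Equiv.Perm.sign τ : ℤ) = (if τ = 1 then 1 else 0) +
      (if τ = t12 then -1 else 0) + (if τ = t13 then -1 else 0) + (if τ = t23 then -1 else 0) +
      (if τ = c1 then 1 else 0) + (if τ = c2 then 1 else 0) := by decide
  rw [h]
  simp [Vv, elt]

/-- The Jacobiator is the opposite of the signed sum of the associators. -/
theorem jacobiator_eq {K A : Type*} [Field K] [AddCommGroup A] [Module K A]
    (μ : A →ₗ[K] A →ₗ[K] A) (x : Fin 3 → A) :
    bra μ (x 0) (bra μ (x 1) (x 2)) + bra μ (x 1) (bra μ (x 2) (x 0)) +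
      bra μ (x 2) (bra μ (x 0) (x 1)) =
    -∑ σ : S3, Vv K σ • assoc μ (x (σ⁻¹ 0)) (x (σ⁻¹ 1)) (x (σ⁻¹ 2)) := by
  have e12 : t12⁻¹ 0 = 1 ∧ t12⁻¹ 1 = 0 ∧ t12⁻¹ 2 = 2 := by decide
  have e13 : t13⁻¹ 0 = 2 ∧ t13⁻¹ 1 = 1 ∧ t13⁻¹ 2 = 0 := by decide
  have e23 : t23⁻¹ 0 = 0 ∧ t23⁻¹ 1 = 2 ∧ t23⁻¹ 2 = 1 := by decide
  have ec1 : c1⁻¹ 0 = 2 ∧ c1⁻¹ 1 = 0 ∧ c1⁻¹ 2 = 1 := by decide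
  have ec2 : c2⁻¹ 0 = 1 ∧ c2⁻¹ 1 = 2 ∧ c2⁻¹ 2 = 0 := by decide
  have s12 : Equiv.Perm.sign t12 = -1 := by decide
  have s13 : Equiv.Perm.sign t13 = -1 := by decide
  have s23 : Equiv.Perm.sign t23 = -1 := by decide
  have sc1 : Equiv.Perm.sign c1 = 1 := by decide
  have sc2 : Equiv.Perm.sign c2 = 1 := by decide
  simp only [sum_S3, Vv_apply, e12, e13, e23, ec1, ec2, s12, s13, s23, sc1, sc2, inv_one,
    Equiv.Perm.one_apply, Equiv.Perm.sign_one, Units.val_one, Units.val_neg, Int.cast_one,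
    Int.cast_neg, one_smul, neg_smul, bra, assoc, map_sub, LinearMap.sub_apply]
  abel

theorem lieAdmissible_iff_assocPhi_Vv {K A : Type*} [Field K] [AddCommGroup A] [Module K A]
    (μ : A →ₗ[K] A →ₗ[K] A) : LieAdmissible μ ↔ assocPhi μ (Vv K) := by
  constructor
  · intro h x
    rw [← neg_eq_zero, ← jacobiator_eq]
    exact h _ _ _
  · intro h x y z
    exact (jacobiator_eq μ ![x, y, z]).trans (neg_eq_zero.mpr (h _))

theorem stmt8 (K : Type*) [Field K] [CharZero K] (A : Type*) [AddCommGroup A] [Module K A]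
    (μ : A →ₗ[K] A →ₗ[K] A) (v : GA K)
    (hstrong : ∀ w : GA K, assocPhi μ w ↔ w ∈ Fv K v) :
    LieAdmissible μ ↔ Vv K ∈ Fv K v := by
  exact (lieAdmissible_iff_assocPhi_Vv μ).trans (hstrong _)
end

section
/- Let F be a three-dimensional invariant subspace of ℝ[Σ₃] containing V = Id − τ₁₂ − τ₁₃ − τ₂₃ + c₁ + c₂. Then F = F_v for some v of one of the following forms: v = (1,t,0,−1,0,−t) = Id + t·τ₁₂ − τ₂₃ − t·c₂ for some t ∈ ℝ with t ≠ 1; or v = (0,−1,0,0,0,1) = −τ₁₂ + c₂; or v = (1,−1,0,−2,2,0) = Id − τ₁₂ − 2τ₂₃ + 2c₁. -/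
open scoped TensorProduct

theorem S3_cases (σ : S3) :
    σ = 1 ∨ σ = t12 ∨ σ = t13 ∨ σ = t23 ∨ σ = c1 ∨ σ = c2 := by
  revert σ; decide

section elt

variable {K : Type*} [Field K]

theorem elt_one (a₁ a₂ a₃ a₄ a₅ a₆ : K) : elt a₁ a₂ a₃ a₄ a₅ a₆ 1 = a₁ := by
  simp [elt, show (1 : S3) ≠ t12 by decide, show (1 : S3) ≠ t13 by decide,
    show (1 : S3) ≠ t23 by decide, show (1 : S3) ≠ c1 by decide, show (1 : S3) ≠ c2 by decide]

theorem elt_t12 (a₁ a₂ a₃ a₄ a₅ a₆ : K) : elt a₁ a₂ a₃ a₄ a₅ a₆ t12 = a₂ := by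
  simp [elt, show t12 ≠ 1 by decide, show t12 ≠ t13 by decide,
    show t12 ≠ t23 by decide, show t12 ≠ c1 by decide, show t12 ≠ c2 by decide]

theorem elt_t13 (a₁ a₂ a₃ a₄ a₅ a₆ : K) : elt a₁ a₂ a₃ a₄ a₅ a₆ t13 = a₃ := by
  simp [elt, show t13 ≠ 1 by decide, show t13 ≠ t12 by decide,
    show t13 ≠ t23 by decide, show t13 ≠ c1 by decide, show t13 ≠ c2 by decide]

theorem elt_t23 (a₁ a₂ a₃ a₄ a₅ a₆ : K) : elt a₁ a₂ a₃ a₄ a₅ a₆ t23 = a₄ := by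
  simp [elt, show t23 ≠ 1 by decide, show t23 ≠ t12 by decide,
    show t23 ≠ t13 by decide, show t23 ≠ c1 by decide, show t23 ≠ c2 by decide]

theorem elt_c1 (a₁ a₂ a₃ a₄ a₅ a₆ : K) : elt a₁ a₂ a₃ a₄ a₅ a₆ c1 = a₅ := by
  simp [elt, show c1 ≠ 1 by decide, show c1 ≠ t12 by decide,
    show c1 ≠ t13 by decide, show c1 ≠ t23 by decide, show c1 ≠ c2 by decide]

theorem elt_c2 (a₁ a₂ a₃ a₄ a₅ a₆ : K) : elt a₁ a₂ a₃ a₄ a₅ a₆ c2 = a₆ := by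
  simp [elt, show c2 ≠ 1 by decide, show c2 ≠ t12 by decide,
    show c2 ≠ t13 by decide, show c2 ≠ t23 by decide, show c2 ≠ c1 by decide]

theorem GA_ext {f g : GA K} (h1 : f 1 = g 1) (h2 : f t12 = g t12) (h3 : f t13 = g t13)
    (h4 : f t23 = g t23) (h5 : f c1 = g c1) (h6 : f c2 = g c2) : f = g := by
  funext σ
  rcases S3_cases σ with rfl | rfl | rfl | rfl | rfl | rfl <;> assumption

theorem exists_eq_elt (f : GA K) : ∃ a₁ a₂ a₃ a₄ a₅ a₆, f = elt a₁ a₂ a₃ a₄ a₅ a₆ := by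
  refine ⟨f 1, f t12, f t13, f t23, f c1, f c2, GA_ext ?_ ?_ ?_ ?_ ?_ ?_⟩ <;>
  simp only [elt_one, elt_t12, elt_t13, elt_t23, elt_c1, elt_c2]

theorem elt_inj {a₁ a₂ a₃ a₄ a₅ a₆ b₁ b₂ b₃ b₄ b₅ b₆ : K} :
    elt a₁ a₂ a₃ a₄ a₅ a₆ = elt b₁ b₂ b₃ b₄ b₅ b₆ ↔
      a₁ = b₁ ∧ a₂ = b₂ ∧ a₃ = b₃ ∧ a₄ = b₄ ∧ a₅ = b₅ ∧ a₆ = b₆ := by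
  constructor
  · intro h
    have h' := congrFun h
    exact ⟨by simpa only [elt_one] using h' 1, by simpa only [elt_t12] using h' t12,
      by simpa only [elt_t13] using h' t13, by simpa only [elt_t23] using h' t23,
      by simpa only [elt_c1] using h' c1, by simpa only [elt_c2] using h' c2⟩
  · rintro ⟨rfl, rfl, rfl, rfl, rfl, rfl⟩
    rfl

theorem elt_add (a₁ a₂ a₃ a₄ a₅ a₆ b₁ b₂ b₃ b₄ b₅ b₆ : K) :
    elt a₁ a₂ a₃ a₄ a₅ a₆ + elt b₁ b₂ b₃ b₄ b₅ b₆ =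
      elt (a₁ + b₁) (a₂ + b₂) (a₃ + b₃) (a₄ + b₄) (a₅ + b₅) (a₆ + b₆) := by
  apply GA_ext <;> simp only [Pi.add_apply, elt_one, elt_t12, elt_t13, elt_t23, elt_c1, elt_c2]

theorem smul_elt (k a₁ a₂ a₃ a₄ a₅ a₆ : K) :
    k • elt a₁ a₂ a₃ a₄ a₅ a₆ =
      elt (k * a₁) (k * a₂) (k * a₃) (k * a₄) (k * a₅) (k * a₆) := by
  apply GA_ext <;>
  simp only [Pi.smul_apply, smul_eq_mul, elt_one, elt_t12, elt_t13, elt_t23, elt_c1, elt_c2]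

theorem elt_zero : elt 0 0 0 0 0 0 = (0 : GA K) := by
  apply GA_ext <;> simp only [Pi.zero_apply, elt_one, elt_t12, elt_t13, elt_t23, elt_c1, elt_c2]

theorem act_t12_elt (a₁ a₂ a₃ a₄ a₅ a₆ : K) :
    act t12 (elt a₁ a₂ a₃ a₄ a₅ a₆) = elt a₂ a₁ a₆ a₅ a₄ a₃ := by
  apply GA_ext <;>
  simp only [act, mul_one, show t12 * t12 = 1 by decide, show t12 * t13 = c2 by decide,
    show t12 * t23 = c1 by decide, show t12 * c1 = t23 by decide, show t12 * c2 = t13 by decide,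
    elt_one, elt_t12, elt_t13, elt_t23, elt_c1, elt_c2]

theorem act_c1_elt (a₁ a₂ a₃ a₄ a₅ a₆ : K) :
    act c1 (elt a₁ a₂ a₃ a₄ a₅ a₆) = elt a₅ a₃ a₄ a₂ a₆ a₁ := by
  apply GA_ext <;>
  simp only [act, mul_one, show c1 * t12 = t13 by decide, show c1 * t13 = t23 by decide,
    show c1 * t23 = t12 by decide, show c1 * c1 = c2 by decide, show c1 * c2 = 1 by decide,
    elt_one, elt_t12, elt_t13, elt_t23, elt_c1, elt_c2]

theorem act_c2_elt (a₁ a₂ a₃ a₄ a₅ a₆ : K) :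
    act c2 (elt a₁ a₂ a₃ a₄ a₅ a₆) = elt a₆ a₄ a₂ a₃ a₁ a₅ := by
  apply GA_ext <;>
  simp only [act, mul_one, show c2 * t12 = t23 by decide, show c2 * t13 = t12 by decide,
    show c2 * t23 = t13 by decide, show c2 * c1 = 1 by decide, show c2 * c2 = c1 by decide,
    elt_one, elt_t12, elt_t13, elt_t23, elt_c1, elt_c2]

end elt

theorem eq_Fv_of_linearIndependent {F : Submodule ℝ (GA ℝ)}
    (hinv : ∀ (σ : S3) (x : GA ℝ), x ∈ F → act σ x ∈ F)
    (hdim : Module.finrank ℝ F = 3) {v : GA ℝ} (hv : v ∈ F)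
    (hli : ∀ x y z : ℝ, x • v + y • act c1 v + z • act c2 v = 0 → x = 0 ∧ y = 0 ∧ z = 0) :
    F = Fv ℝ v := by
  have hle : Fv ℝ v ≤ F := by
    rw [Fv, Submodule.span_le]
    rintro _ ⟨σ, rfl⟩
    exact hinv σ v hv
  refine (Submodule.eq_of_le_of_finrank_le hle ?_).symm
  have hind : LinearIndependent ℝ ![v, act c1 v, act c2 v] := by
    rw [Fintype.linearIndependent_iff]
    intro g hg
    simp only [Fin.sum_univ_three, Matrix.cons_val] at hg
    obtain ⟨h0, h1, h2⟩ := hli _ _ _ hg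
    intro i
    fin_cases i <;> assumption
  have hspan : Submodule.span ℝ (Set.range ![v, act c1 v, act c2 v]) ≤ Fv ℝ v := by
    rw [Submodule.span_le]
    rintro _ ⟨i, rfl⟩
    have hone : act 1 v = v := by funext τ; simp [act]
    fin_cases i
    · exact Submodule.subset_span ⟨1, hone⟩
    · exact Submodule.subset_span ⟨c1, rfl⟩
    · exact Submodule.subset_span ⟨c2, rfl⟩
  have hcard := finrank_span_eq_card hind
  replace hcard := hcard.trans (Fintype.card_fin 3)
  rw [hdim, ← hcard]
  exact Submodule.finrank_mono hspan

/-- The projection onto the `t12`-fixed vectors of the standard isotypic component. -/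
theorem standard_fixed_mem {F : Submodule ℝ (GA ℝ)}
    (hinv : ∀ (σ : S3) (x : GA ℝ), x ∈ F → act σ x ∈ F) {a₁ a₂ a₃ a₄ a₅ a₆ : ℝ}
    (hx : elt a₁ a₂ a₃ a₄ a₅ a₆ ∈ F) {a b c : ℝ}
    (ha : a = 2 * (a₁ + a₂) - (a₃ + a₆) - (a₄ + a₅))
    (hb : b = 2 * (a₃ + a₆) - (a₁ + a₂) - (a₄ + a₅))
    (hc : c = 2 * (a₄ + a₅) - (a₁ + a₂) - (a₃ + a₆)) :
    elt a a b c c b ∈ F := by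
  have h1 := F.add_mem hx (hinv t12 _ hx)
  have h2 := F.add_mem (hinv c1 _ h1) (hinv c2 _ h1)
  have h3 := F.add_mem (F.smul_mem 2 h1) (F.smul_mem (-1) h2)
  simp only [act_t12_elt, act_c1_elt, act_c2_elt, elt_add, smul_elt] at h3
  convert h3 using 1
  rw [elt_inj]
  subst ha hb hc
  refine ⟨?_, ?_, ?_, ?_, ?_, ?_⟩ <;> ring

theorem exists_standard_fixed {F : Submodule ℝ (GA ℝ)}
    (hinv : ∀ (σ : S3) (x : GA ℝ), x ∈ F → act σ x ∈ F) (hdim : Module.finrank ℝ F = 3) :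
    ∃ a b c : ℝ, a + b + c = 0 ∧ ¬(b = 0 ∧ c = 0) ∧ elt a a b c c b ∈ F := by
  by_contra! hno
  have key : ∀ a₁ a₂ a₃ a₄ a₅ a₆ : ℝ, elt a₁ a₂ a₃ a₄ a₅ a₆ ∈ F →
      2 * (a₃ + a₆) - (a₁ + a₂) - (a₄ + a₅) = 0 ∧
        2 * (a₄ + a₅) - (a₁ + a₂) - (a₃ + a₆) = 0 := by
    intro a₁ a₂ a₃ a₄ a₅ a₆ hx
    by_contra hne
    refine hno _ _ _ ?_ (fun h0 h1 => hne ⟨h0, h1⟩) (standard_fixed_mem hinv hx rfl rfl rfl)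
    ring
  have hle : F ≤ Submodule.span ℝ (Set.range ![Vv ℝ, Wv ℝ]) := by
    intro x hx
    obtain ⟨a₁, a₂, a₃, a₄, a₅, a₆, rfl⟩ := exists_eq_elt x
    obtain ⟨h1, h2⟩ := key _ _ _ _ _ _ hx
    have hx1 := hinv c1 _ hx
    rw [act_c1_elt] at hx1
    obtain ⟨h3, h4⟩ := key _ _ _ _ _ _ hx1
    have hx2 := hinv c2 _ hx
    rw [act_c2_elt] at hx2
    obtain ⟨h5, h6⟩ := key _ _ _ _ _ _ hx2
    have hsum : elt a₁ a₂ a₃ a₄ a₅ a₆ =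
        ((a₁ - a₂) / 2) • Vv ℝ + ((a₁ + a₂) / 2) • Wv ℝ := by
      rw [Vv, Wv, smul_elt, smul_elt, elt_add, elt_inj]
      refine ⟨?_, ?_, ?_, ?_, ?_, ?_⟩ <;> linarith
    rw [hsum]
    exact Submodule.add_mem _ (Submodule.smul_mem _ _ (Submodule.subset_span ⟨0, rfl⟩))
      (Submodule.smul_mem _ _ (Submodule.subset_span ⟨1, rfl⟩))
  have h2 := (Submodule.finrank_mono hle).trans (finrank_range_le_card ![Vv ℝ, Wv ℝ])
  rw [hdim, Fintype.card_fin] at h2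
  omega

theorem stmt11 (F : Submodule ℝ (GA ℝ))
    (hinv : ∀ (σ : S3) (x : GA ℝ), x ∈ F → act σ x ∈ F)
    (hdim : Module.finrank ℝ F = 3) (hV : Vv ℝ ∈ F) :
    (∃ t : ℝ, t ≠ 1 ∧ F = Fv ℝ (elt 1 t 0 (-1) 0 (-t)))
    ∨ F = Fv ℝ (elt 0 (-1) 0 0 0 1)
    ∨ F = Fv ℝ (elt 1 (-1) 0 (-2) 2 0) := by
  obtain ⟨a, b, c, habc, hne, he⟩ := exists_standard_fixed hinv hdim
  have hcomb : ∀ l p q : ℝ, elt (l + p * a + q * c) (-l + p * a + q * b) (-l + p * b + q * c)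
      (-l + p * c + q * a) (l + p * c + q * b) (l + p * b + q * a) ∈ F := by
    intro l p q
    have h := F.add_mem (F.add_mem (F.smul_mem l hV) (F.smul_mem p he))
      (F.smul_mem q (hinv c1 _ he))
    simpa only [Vv, act_c1_elt, elt_add, smul_elt, mul_one, mul_neg] using h
  obtain rfl : a = -b - c := by linarith
  by_cases hc : c = 0
  · subst hc
    have hb : b ≠ 0 := fun h => hne ⟨h, rfl⟩
    refine Or.inr (Or.inl (eq_Fv_of_linearIndependent hinv hdim ?_ ?_))
    · convert hcomb (1 / 3) (1 / (3 * b)) (-1 / (3 * b)) using 1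
      rw [elt_inj]
      refine ⟨?_, ?_, ?_, ?_, ?_, ?_⟩ <;> field_simp <;> ring
    · intro x y z h
      simp only [act_c1_elt, act_c2_elt, elt_add, smul_elt, ← elt_zero, elt_inj] at h
      obtain ⟨h1, h2, h3, h4, h5, h6⟩ := h
      refine ⟨?_, ?_, ?_⟩ <;> linarith
  by_cases hbc : b = c
  · subst hbc
    refine Or.inr (Or.inr (eq_Fv_of_linearIndependent hinv hdim ?_ ?_))
    · convert hcomb 1 (1 / (3 * b)) (2 / (3 * b)) using 1
      rw [elt_inj]
      refine ⟨?_, ?_, ?_, ?_, ?_, ?_⟩ <;> field_simp <;> ring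
    · intro x y z h
      simp only [act_c1_elt, act_c2_elt, elt_add, smul_elt, ← elt_zero, elt_inj] at h
      obtain ⟨h1, h2, h3, h4, h5, h6⟩ := h
      refine ⟨?_, ?_, ?_⟩ <;> linarith
  have ht : b / c ≠ 1 := fun h => hbc ((div_eq_one_iff_eq hc).mp h)
  refine Or.inl ⟨b / c, ht, eq_Fv_of_linearIndependent hinv hdim ?_ ?_⟩
  · convert hcomb ((1 - b / c) / 3) (-1 / (3 * c)) (1 / (3 * c)) using 1
    rw [elt_inj]
    refine ⟨?_, ?_, ?_, ?_, ?_, ?_⟩ <;> field_simp <;> ring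
  · intro x y z h
    generalize b / c = t at h ht
    simp only [act_c1_elt, act_c2_elt, elt_add, smul_elt, ← elt_zero, elt_inj] at h
    obtain ⟨h1, h2, h3, h4, h5, h6⟩ := h
    have hxy : x = y := by linarith
    have hxz : x = z := by linarith
    subst hxy hxz
    have hx : x = 0 := by
      have : (1 - t) * x = 0 := by linarith
      exact (mul_eq_zero.mp this).resolve_left (sub_ne_zero.mpr ht.symm)
    exact ⟨hx, hx, hx⟩
end

section
/- Let K be a field of characteristic zero and (A,μ) a K-algebra. Then the identity 2·A_μ(x,y,z) + A_μ(y,x,z) + A_μ(z,y,x) + A_μ(x,z,y) + A_μ(y,z,x) = 0 holds for all x,y,z ∈ A if and only if (A,μ) is alternative, i.e. A_μ(x,x,y) = 0 and A_μ(y,x,x) = 0 for all x,y ∈ A. -/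
open scoped TensorProduct

theorem assoc_swap_left {K A : Type*} [Field K] [AddCommGroup A] [Module K A]
    {μ : A →ₗ[K] A →ₗ[K] A} (h : ∀ x y : A, assoc μ x x y = 0) (x y z : A) :
    assoc μ y x z = -assoc μ x y z := by
  have hxy := h (x + y) z
  have hx := h x z
  have hy := h y z
  simp only [assoc, map_add, LinearMap.add_apply] at *
  linear_combination (norm := module) hxy - hx - hy

theorem assoc_swap_right {K A : Type*} [Field K] [AddCommGroup A] [Module K A]
    {μ : A →ₗ[K] A →ₗ[K] A} (h : ∀ x y : A, assoc μ y x x = 0) (x y z : A) :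
    assoc μ x z y = -assoc μ x y z := by
  have hyz := h (y + z) x
  have hy := h y x
  have hz := h z x
  simp only [assoc, map_add, LinearMap.add_apply] at *
  linear_combination (norm := module) hyz - hy - hz

theorem stmt14 (K : Type*) [Field K] [CharZero K] (A : Type*) [AddCommGroup A] [Module K A]
    (μ : A →ₗ[K] A →ₗ[K] A) :
    (∀ x y z : A,
      (2 : K) • assoc μ x y z + assoc μ y x z + assoc μ z y x
        + assoc μ x z y + assoc μ y z x = 0)
    ↔ ((∀ x y : A, assoc μ x x y = 0) ∧ (∀ x y : A, assoc μ y x x = 0)) := by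
  constructor
  · intro h
    refine ⟨fun x y => ?_, fun x y => ?_⟩
    · have h18 : (18 : K) • assoc μ x x y = 0 := by
        linear_combination (norm := module) (7 : K) • h x x y - (5 : K) • h x y x + h y x x
      exact (smul_eq_zero.mp h18).resolve_left (by norm_num)
    · have h18 : (18 : K) • assoc μ y x x = 0 := by
        linear_combination (norm := module) (-5 : K) • h x x y + h x y x + (7 : K) • h y x x
      exact (smul_eq_zero.mp h18).resolve_left (by norm_num)
  · rintro ⟨hl, hr⟩ x y z
    have h₁ := assoc_swap_left hl x y z
    have h₂ := assoc_swap_right hr x y z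
    have h₃ := assoc_swap_left hl y z x
    linear_combination (norm := module) h₁ + h₂ + h₃
end

section
/- Let K be a field of characteristic zero and let A, B be K-algebras which are 𝒱-algebras: there exist nonzero v, w ∈ K[Σ₃] with A_{μ_A}∘Φ_v = 0 and A_{μ_B}∘Φ_w = 0. For a K-algebra C and σ ∈ Σ₃ define the trilinear maps L^C_σ(x₁,x₂,x₃) = (x_{σ⁻¹(1)}·x_{σ⁻¹(2)})·x_{σ⁻¹(3)} and R^C_σ(x₁,x₂,x₃) = x_{σ⁻¹(1)}·(x_{σ⁻¹(2)}·x_{σ⁻¹(3)}). Assume the nondegeneracy condition that for C = A every vanishing linear combination Σ_σ (b_σ L^A_σ + c_σ R^A_σ) = 0 satisfies c_σ = −b_σ for all σ and Σ_σ b_σ σ ∈ F_v, and likewise for C = B with F_w. Equip the tensor product A⊗_K B with the product (a₁⊗b₁)·(a₂⊗b₂) = (a₁·a₂)⊗(b₁·b₂). Then A⊗_K B is a 𝒱-algebra (i.e. there exists a nonzero v' ∈ K[Σ₃] with A_{μ_{A⊗B}}∘Φ_{v'} = 0) if and only if A and B are both associative. -/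
open scoped TensorProduct

section TensorProductAlgebras

variable {K A B : Type*} [Field K] [AddCommGroup A] [Module K A] [AddCommGroup B] [Module K B]
  {μA : A →ₗ[K] A →ₗ[K] A} {μB : B →ₗ[K] B →ₗ[K] B}

/-- If the only relations between the degree-three monomials of `B` are relations between
associators, then an identity between associators of `A ⊗ B` with a nonzero coefficient forces
`A` to be associative. -/
theorem associative_of_sum_tmul_eq_zero
    (hB : ∀ b c : GA K,
      (∀ y : Fin 3 → B, ∑ σ : S3, (b σ • Lterm μB σ y + c σ • Rterm μB σ y) = 0) →
      ∀ σ : S3, c σ = -(b σ))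
    {u : GA K} (hu : u ≠ 0)
    (h : ∀ (x : Fin 3 → A) (y : Fin 3 → B),
      ∑ σ : S3, u σ • (Lterm μA σ x ⊗ₜ[K] Lterm μB σ y - Rterm μA σ x ⊗ₜ[K] Rterm μB σ y) = 0)
    (a₁ a₂ a₃ : A) : μA (μA a₁ a₂) a₃ = μA a₁ (μA a₂ a₃) := by
  obtain ⟨σ, hσ⟩ := Function.ne_iff.mp hu
  have key (x : Fin 3 → A) : Lterm μA σ x = Rterm μA σ x := by
    rw [← sub_eq_zero, ← Module.forall_dual_apply_eq_zero_iff K]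
    intro φ
    have hφ := hB (fun τ => u τ * φ (Lterm μA τ x)) (fun τ => -(u τ * φ (Rterm μA τ x)))
      (fun y => by
        have hxy := congrArg (TensorProduct.lid K B ∘ φ.rTensor B) (h x y)
        simpa [smul_sub, sub_eq_add_neg, mul_smul] using hxy) σ
    rw [map_sub, sub_eq_zero]
    exact (mul_left_cancel₀ hσ (neg_injective hφ)).symm
  simpa [Lterm, Rterm] using key (![a₁, a₂, a₃] ∘ σ)

/-- The tensor product of two associative algebras is associative. -/
theorem assoc_eq_zero_of_associative
    (hA : ∀ a₁ a₂ a₃ : A, μA (μA a₁ a₂) a₃ = μA a₁ (μA a₂ a₃))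
    (hB : ∀ b₁ b₂ b₃ : B, μB (μB b₁ b₂) b₃ = μB b₁ (μB b₂ b₃))
    {μT : A ⊗[K] B →ₗ[K] A ⊗[K] B →ₗ[K] A ⊗[K] B}
    (hμT : ∀ (a₁ a₂ : A) (b₁ b₂ : B),
      μT (a₁ ⊗ₜ[K] b₁) (a₂ ⊗ₜ[K] b₂) = μA a₁ a₂ ⊗ₜ[K] μB b₁ b₂)
    (x y z : A ⊗[K] B) : assoc μT x y z = 0 := by
  rw [assoc, sub_eq_zero]
  induction x with
  | zero => simp
  | add x₁ x₂ h₁ h₂ => simp [h₁, h₂]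
  | tmul a₁ b₁ =>
    induction y with
    | zero => simp
    | add y₁ y₂ h₁ h₂ => simp [h₁, h₂]
    | tmul a₂ b₂ =>
      induction z with
      | zero => simp
      | add z₁ z₂ h₁ h₂ => simp [h₁, h₂]
      | tmul a₃ b₃ => simp [hμT, hA, hB]

end TensorProductAlgebras

theorem stmt15 (K : Type*) [Field K] [CharZero K]
    (A B : Type*) [AddCommGroup A] [Module K A] [AddCommGroup B] [Module K B]
    (μA : A →ₗ[K] A →ₗ[K] A) (μB : B →ₗ[K] B →ₗ[K] B)
    (v w : GA K) (hv : v ≠ 0) (hw : w ≠ 0)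
    (hAv : assocPhi μA v) (hBw : assocPhi μB w)
    (hndA : ∀ b c : GA K,
      (∀ x : Fin 3 → A, ∑ σ : S3, (b σ • Lterm μA σ x + c σ • Rterm μA σ x) = 0) →
      (∀ σ : S3, c σ = -(b σ)) ∧ b ∈ Fv K v)
    (hndB : ∀ b c : GA K,
      (∀ x : Fin 3 → B, ∑ σ : S3, (b σ • Lterm μB σ x + c σ • Rterm μB σ x) = 0) →
      (∀ σ : S3, c σ = -(b σ)) ∧ b ∈ Fv K w)
    (μT : TensorProduct K A B →ₗ[K] TensorProduct K A B →ₗ[K] TensorProduct K A B)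
    (hμT : ∀ (a₁ a₂ : A) (b₁ b₂ : B),
      μT (a₁ ⊗ₜ[K] b₁) (a₂ ⊗ₜ[K] b₂) = (μA a₁ a₂) ⊗ₜ[K] (μB b₁ b₂)) :
    (∃ v' : GA K, v' ≠ 0 ∧ assocPhi μT v') ↔
      ((∀ a₁ a₂ a₃ : A, μA (μA a₁ a₂) a₃ = μA a₁ (μA a₂ a₃)) ∧
       (∀ b₁ b₂ b₃ : B, μB (μB b₁ b₂) b₃ = μB b₁ (μB b₂ b₃))) := by
  constructor
  · rintro ⟨u, hu, h⟩
    have hAB (x : Fin 3 → A) (y : Fin 3 → B) : ∑ σ : S3, u σ •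
        (Lterm μA σ x ⊗ₜ[K] Lterm μB σ y - Rterm μA σ x ⊗ₜ[K] Rterm μB σ y) = 0 := by
      simpa [assoc, hμT, Lterm, Rterm] using h (fun i => x i ⊗ₜ[K] y i)
    have hBA (y : Fin 3 → B) (x : Fin 3 → A) : ∑ σ : S3, u σ •
        (Lterm μB σ y ⊗ₜ[K] Lterm μA σ x - Rterm μB σ y ⊗ₜ[K] Rterm μA σ x) = 0 := by
      simpa using congrArg (TensorProduct.comm K A B) (hAB x y)
    exact ⟨associative_of_sum_tmul_eq_zero (fun b c hbc => (hndB b c hbc).1) hu hAB,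
      associative_of_sum_tmul_eq_zero (fun b c hbc => (hndA b c hbc).1) hu hBA⟩
  · rintro ⟨hA, hB⟩
    exact ⟨v, hv, fun x => by simp [assoc_eq_zero_of_associative hA hB hμT]⟩
end

section
/- Let K be a field of characteristic zero and (A,μ) a K-algebra such that A^L_μ∘Φ_v − A^R_μ∘Φ_w = 0 for some v, w ∈ K[Σ₃], where A^L_μ(x₁,x₂,x₃) = (x₁·x₂)·x₃, A^R_μ(x₁,x₂,x₃) = x₁·(x₂·x₃), and A^L_μ∘Φ_u means Σ_σ a_σ A^L_μ∘Φ_σ for u = Σ_σ a_σ σ. Suppose there are scalars a_σ ∈ K (σ ∈ Σ₃) with Σ_σ a_σ (σ·v) = V, where V = Id − τ₁₂ − τ₁₃ − τ₂₃ + c₁ + c₂, and set u' = Σ_σ a_σ (σ·(w−v)). If there exists χ' = Σ_σ c_σ σ ∈ K[Σ₃] such that Σ_σ c_σ (σ·u') = 0 and Σ_σ c_σ (σ·V) ≠ 0, then (A,μ) is Lie-admissible. -/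
open scoped TensorProduct

/-- The sign of a permutation of three letters, as a scalar. -/
def sg (K : Type*) [Field K] (σ : S3) : K := ((Equiv.Perm.sign σ : ℤ) : K)

theorem sg_mul (K : Type*) [Field K] (σ τ : S3) : sg K (σ * τ) = sg K σ * sg K τ := by
  simp [sg]

theorem sg_inv (K : Type*) [Field K] (σ : S3) : sg K σ⁻¹ = sg K σ := by
  simp [sg]

theorem sg_mul_self (K : Type*) [Field K] (σ : S3) : sg K σ * sg K σ = 1 := by
  rw [← sg_mul]
  simp [sg]

/-- The linear extension of the sign character to the group algebra. -/
def sgSum {K : Type*} [Field K] : GA K →ₗ[K] K where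
  toFun v := ∑ σ : S3, sg K σ * v σ
  map_add' v w := by simp [mul_add, Finset.sum_add_distrib]
  map_smul' r v := by simp [Finset.mul_sum, mul_left_comm]

theorem sgSum_apply {K : Type*} [Field K] (v : GA K) : sgSum v = ∑ σ : S3, sg K σ * v σ := rfl

theorem sgSum_act {K : Type*} [Field K] (ρ : S3) (v : GA K) :
    sgSum (act ρ v) = sg K ρ * sgSum v := by
  simp only [sgSum_apply, act]
  rw [← Equiv.sum_comp (Equiv.mulLeft ρ) fun σ => sg K σ * v σ, Finset.mul_sum]
  refine Finset.sum_congr rfl fun τ _ => ?_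
  rw [Equiv.coe_mulLeft, sg_mul, ← mul_assoc, ← mul_assoc, sg_mul_self, one_mul]

theorem sgSum_sum_act {K : Type*} [Field K] (a v : GA K) :
    sgSum (∑ σ : S3, a σ • act σ v) = sgSum a * sgSum v := by
  simp only [map_sum, map_smul, sgSum_act, smul_eq_mul]
  rw [sgSum_apply a, Finset.sum_mul]
  exact Finset.sum_congr rfl fun σ _ => by ring

theorem Vv_eq_sg (K : Type*) [Field K] : Vv K = sg K := by
  have key : ∀ σ : S3, (if σ = 1 then (1 : ℤ) else 0) + (if σ = t12 then -1 else 0) +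
      (if σ = t13 then -1 else 0) + (if σ = t23 then -1 else 0) + (if σ = c1 then 1 else 0) +
      (if σ = c2 then 1 else 0) = (Equiv.Perm.sign σ : ℤ) := by decide
  funext σ
  rw [sg, ← key σ]
  simp [Vv, elt]

theorem act_Vv (K : Type*) [Field K] (ρ : S3) : act ρ (Vv K) = sg K ρ • Vv K := by
  funext τ
  simp [act, Vv_eq_sg, sg_mul]

theorem sgSum_Vv_ne_zero (K : Type*) [Field K] [CharZero K] : sgSum (Vv K) ≠ 0 := by
  simp [sgSum_apply, Vv_eq_sg, sg_mul_self, Fintype.card_perm, Nat.factorial_ne_zero]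

/-- Antisymmetrizing `∑ v σ F(σ)` over right translations only sees the sign character of `v`. -/
theorem antisymm_sum {K M : Type*} [Field K] [AddCommGroup M] [Module K M] (v : GA K)
    (F : S3 → M) :
    ∑ ρ : S3, sg K ρ • ∑ σ : S3, v σ • F (σ * ρ⁻¹) = sgSum v • ∑ τ : S3, sg K τ • F τ := by
  rw [sgSum_apply, Finset.sum_smul]
  simp only [Finset.smul_sum]
  rw [Finset.sum_comm]
  refine Finset.sum_congr rfl fun σ _ => ?_
  rw [← Equiv.sum_comp ((Equiv.inv S3).trans (Equiv.mulRight σ))]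
  refine Finset.sum_congr rfl fun ρ _ => ?_
  simp only [Equiv.trans_apply, Equiv.inv_apply, Equiv.coe_mulRight, sg_mul, sg_inv, smul_smul]
  congr 1
  · ring
  · congr 1
    group

theorem Lterm_comp {K A : Type*} [Field K] [AddCommGroup A] [Module K A]
    (μ : A →ₗ[K] A →ₗ[K] A) (σ ρ : S3) (x : Fin 3 → A) :
    Lterm μ σ (x ∘ ρ) = Lterm μ (σ * ρ⁻¹) x := by
  simp [Lterm]

theorem Rterm_comp {K A : Type*} [Field K] [AddCommGroup A] [Module K A]
    (μ : A →ₗ[K] A →ₗ[K] A) (σ ρ : S3) (x : Fin 3 → A) :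
    Rterm μ σ (x ∘ ρ) = Rterm μ (σ * ρ⁻¹) x := by
  simp [Rterm]

theorem lieAdmissible_of_antisymm {K A : Type*} [Field K] [AddCommGroup A] [Module K A]
    (μ : A →ₗ[K] A →ₗ[K] A)
    (h : ∀ x : Fin 3 → A, ∑ τ : S3, sg K τ • Lterm μ τ x = ∑ τ : S3, sg K τ • Rterm μ τ x) :
    LieAdmissible μ := by
  intro x y z
  have H := h ![x, y, z]
  have s12 : sg K t12 = -1 := by simp [sg, show Equiv.Perm.sign t12 = -1 by decide]
  have s13 : sg K t13 = -1 := by simp [sg, show Equiv.Perm.sign t13 = -1 by decide]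
  have s23 : sg K t23 = -1 := by simp [sg, show Equiv.Perm.sign t23 = -1 by decide]
  have sc1 : sg K c1 = 1 := by simp [sg, show Equiv.Perm.sign c1 = 1 by decide]
  have sc2 : sg K c2 = 1 := by simp [sg, show Equiv.Perm.sign c2 = 1 by decide]
  have s1 : sg K 1 = 1 := by simp [sg]
  rw [sum_S3, sum_S3, s1, s12, s13, s23, sc1, sc2] at H
  simp only [Lterm, Rterm,
    show (1 : S3)⁻¹ 0 = 0 by decide, show (1 : S3)⁻¹ 1 = 1 by decide,
    show (1 : S3)⁻¹ 2 = 2 by decide,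
    show t12⁻¹ 0 = 1 by decide, show t12⁻¹ 1 = 0 by decide, show t12⁻¹ 2 = 2 by decide,
    show t13⁻¹ 0 = 2 by decide, show t13⁻¹ 1 = 1 by decide, show t13⁻¹ 2 = 0 by decide,
    show t23⁻¹ 0 = 0 by decide, show t23⁻¹ 1 = 2 by decide, show t23⁻¹ 2 = 1 by decide,
    show c1⁻¹ 0 = 2 by decide, show c1⁻¹ 1 = 0 by decide, show c1⁻¹ 2 = 1 by decide,
    show c2⁻¹ 0 = 1 by decide, show c2⁻¹ 1 = 2 by decide, show c2⁻¹ 2 = 0 by decide,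
    Matrix.cons_val, one_smul, neg_smul] at H
  rw [← sub_eq_zero] at H
  rw [← neg_eq_zero, ← H]
  simp only [bra, map_sub, LinearMap.sub_apply]
  abel

theorem stmt17 (K : Type*) [Field K] [CharZero K] (A : Type*) [AddCommGroup A] [Module K A]
    (μ : A →ₗ[K] A →ₗ[K] A) (v w : GA K)
    (hLR : ∀ x : Fin 3 → A,
      (∑ σ : S3, v σ • Lterm μ σ x) - (∑ σ : S3, w σ • Rterm μ σ x) = 0)
    (a : GA K) (ha : (∑ σ : S3, a σ • act σ v) = Vv K)
    (c : GA K)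
    (hc0 : (∑ σ : S3, c σ • act σ (∑ σ' : S3, a σ' • act σ' (w - v))) = 0)
    (hcV : (∑ σ : S3, c σ • act σ (Vv K)) ≠ 0) :
    LieAdmissible μ := by
  have hav : sgSum a * sgSum v ≠ 0 := by
    rw [← sgSum_sum_act, ha]
    exact sgSum_Vv_ne_zero K
  have hc : sgSum c ≠ 0 := by
    intro h
    apply hcV
    simp only [act_Vv, smul_smul, ← Finset.sum_smul]
    rw [show ∑ σ : S3, c σ * sg K σ = sgSum c by simp only [sgSum_apply, mul_comm], h, zero_smul]
  have hvw : sgSum w = sgSum v := by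
    have h := congrArg sgSum hc0
    rw [sgSum_sum_act, sgSum_sum_act, map_zero, map_sub] at h
    have ha0 := left_ne_zero_of_mul hav
    simpa [hc, ha0, sub_eq_zero] using h
  refine lieAdmissible_of_antisymm μ fun x => ?_
  have h : ∑ ρ : S3, sg K ρ • ∑ σ : S3, v σ • Lterm μ σ (x ∘ ρ) =
      ∑ ρ : S3, sg K ρ • ∑ σ : S3, w σ • Rterm μ σ (x ∘ ρ) :=
    Finset.sum_congr rfl fun ρ _ => by rw [sub_eq_zero.mp (hLR (x ∘ ρ))]
  simp only [Lterm_comp, Rterm_comp] at h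
  rw [antisymm_sum v fun τ => Lterm μ τ x, antisymm_sum w fun τ => Rterm μ τ x, hvw] at h
  exact smul_right_injective A (right_ne_zero_of_mul hav) h
end

section
/- Let K be a field of characteristic zero and let A, B be K-algebras each satisfying the identity μ(μ(x₁,x₂),x₃) = μ(x₂,μ(x₁,x₃)) for all elements x₁, x₂, x₃. Equip A⊗_K B with the product (a₁⊗b₁)·(a₂⊗b₂) = (a₁·a₂)⊗(b₁·b₂). Then A⊗_K B satisfies the same identity: (X₁·X₂)·X₃ = X₂·(X₁·X₃) for all X₁, X₂, X₃ ∈ A⊗_K B. In other words, the class of algebras satisfying (x₁x₂)x₃ = x₂(x₁x₃) is stable under tensor products. -/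
open scoped TensorProduct

theorem stmt18 (K : Type*) [Field K] [CharZero K]
    (A B : Type*) [AddCommGroup A] [Module K A] [AddCommGroup B] [Module K B]
    (μA : A →ₗ[K] A →ₗ[K] A) (μB : B →ₗ[K] B →ₗ[K] B)
    (hA : ∀ x₁ x₂ x₃ : A, μA (μA x₁ x₂) x₃ = μA x₂ (μA x₁ x₃))
    (hB : ∀ x₁ x₂ x₃ : B, μB (μB x₁ x₂) x₃ = μB x₂ (μB x₁ x₃))
    (μT : TensorProduct K A B →ₗ[K] TensorProduct K A B →ₗ[K] TensorProduct K A B)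
    (hμT : ∀ (a₁ a₂ : A) (b₁ b₂ : B),
      μT (a₁ ⊗ₜ[K] b₁) (a₂ ⊗ₜ[K] b₂) = (μA a₁ a₂) ⊗ₜ[K] (μB b₁ b₂)) :
    ∀ X₁ X₂ X₃ : TensorProduct K A B, μT (μT X₁ X₂) X₃ = μT X₂ (μT X₁ X₃) := by
  intro X₁ X₂ X₃
  induction X₁ using TensorProduct.induction_on with
  | zero => simp
  | add x y hx hy => simp only [map_add, LinearMap.add_apply, hx, hy]
  | tmul a₁ b₁ =>
    induction X₂ using TensorProduct.induction_on with
    | zero => simp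
    | add x y hx hy => simp only [map_add, LinearMap.add_apply, hx, hy]
    | tmul a₂ b₂ =>
      induction X₃ using TensorProduct.induction_on with
      | zero => simp
      | add x y hx hy => simp only [map_add, hx, hy]
      | tmul a₃ b₃ => simp only [hμT, hA, hB]
end

section
/- Let K be a field of characteristic zero and let A, B be K-algebras; equip A⊗_K B with the product (a₁⊗b₁)·(a₂⊗b₂) = (a₁·a₂)⊗(b₁·b₂). Call A a V-algebra if Σ_{σ∈Σ₃} sgn(σ)·A_μ(x_{σ(1)},x_{σ(2)},x_{σ(3)}) = 0 for all x₁,x₂,x₃ ∈ A, and a W-algebra if Σ_{σ∈Σ₃} A_μ(x_{σ(1)},x_{σ(2)},x_{σ(3)}) = 0 for all x₁,x₂,x₃ ∈ A. Call B a V!-algebra if B is associative and x₁·x₂·x₃ = x_{σ(1)}·x_{σ(2)}·x_{σ(3)} for every σ ∈ Σ₃ and all x₁,x₂,x₃ ∈ B, and a W!-algebra if B is associative and x₁·x₂·x₃ = −x₂·x₁·x₃ = −x₁·x₃·x₂ for all x₁,x₂,x₃ ∈ B. Then: (1) if A is a V-algebra and B a W!-algebra, A⊗B is a W-algebra; (2)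 if A is a W-algebra and B a V!-algebra, A⊗B is a W-algebra; (3) if A is a W-algebra and B a W!-algebra, A⊗B is a V-algebra. -/
open scoped TensorProduct

/-- `(A,μ)` is a V-algebra (Lie-admissible): the signed sum of the associator over `Σ₃` vanishes. -/
def IsVAlg {K A : Type*} [Field K] [AddCommGroup A] [Module K A]
    (μ : A →ₗ[K] A →ₗ[K] A) : Prop :=
  ∀ x : Fin 3 → A,
    ∑ σ : S3, ((Equiv.Perm.sign σ : ℤ) : K) • assoc μ (x (σ 0)) (x (σ 1)) (x (σ 2)) = 0

/-- `(A,μ)` is a W-algebra (power-associative): the sum of the associator over `Σ₃` vanishes. -/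
def IsWAlg {K A : Type*} [Field K] [AddCommGroup A] [Module K A]
    (μ : A →ₗ[K] A →ₗ[K] A) : Prop :=
  ∀ x : Fin 3 → A, ∑ σ : S3, assoc μ (x (σ 0)) (x (σ 1)) (x (σ 2)) = 0

/-- `(B,μ)` is an algebra over the dual operad of the V (Lie-admissible) operad:
associative with totally symmetric triple products. -/
def IsVDualAlg {K A : Type*} [Field K] [AddCommGroup A] [Module K A]
    (μ : A →ₗ[K] A →ₗ[K] A) : Prop :=
  (∀ x y z : A, μ (μ x y) z = μ x (μ y z)) ∧
  ∀ (σ : S3) (x : Fin 3 → A), μ (μ (x 0) (x 1)) (x 2) = μ (μ (x (σ 0)) (x (σ 1))) (x (σ 2))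

/-- `(B,μ)` is an algebra over the dual operad of the W (power-associative) operad:
associative with `x₁x₂x₃ = -x₂x₁x₃ = -x₁x₃x₂`. -/
def IsWDualAlg {K A : Type*} [Field K] [AddCommGroup A] [Module K A]
    (μ : A →ₗ[K] A →ₗ[K] A) : Prop :=
  (∀ x y z : A, μ (μ x y) z = μ x (μ y z)) ∧
  (∀ x y z : A, μ (μ x y) z = -(μ (μ y x) z)) ∧
  (∀ x y z : A, μ (μ x y) z = -(μ (μ x z) y))

/-- The associator as a multilinear map in its three arguments. -/
def assocMultilinear {K A : Type*} [Field K] [AddCommGroup A] [Module K A]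
    (μ : A →ₗ[K] A →ₗ[K] A) : MultilinearMap K (fun _ : Fin 3 => A) A where
  toFun x := assoc μ (x 0) (x 1) (x 2)
  map_update_add' {inst} m i x y := by
    obtain rfl := Subsingleton.elim inst (instDecidableEqFin 3)
    fin_cases i <;> simp [assoc, Function.update] <;> abel
  map_update_smul' {inst} m i c x := by
    obtain rfl := Subsingleton.elim inst (instDecidableEqFin 3)
    fin_cases i <;> simp [assoc, Function.update, smul_sub]

/-- A multilinear map on tensor products that vanishes on pure tensors vanishes. -/
theorem MultilinearMap.eq_zero_of_forall_tmul {ι K A B M : Type*} [Fintype ι] [DecidableEq ι]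
    [Field K] [AddCommGroup A] [Module K A] [AddCommGroup B] [Module K B]
    [AddCommGroup M] [Module K M] (f : MultilinearMap K (fun _ : ι => A ⊗[K] B) M)
    (hf : ∀ (a : ι → A) (b : ι → B), f (fun i => a i ⊗ₜ[K] b i) = 0)
    (x : ι → A ⊗[K] B) : f x = 0 := by
  choose S hS using fun i => TensorProduct.exists_finset (x i)
  obtain rfl : x = fun i => ∑ p ∈ S i, p.1 ⊗ₜ[K] p.2 := funext hS
  rw [MultilinearMap.map_sum_finset]
  exact Finset.sum_eq_zero fun r _ => hf (fun i => (r i).1) (fun i => (r i).2)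

/-- If triple products in an associative algebra `B` transform under permutations by `ε`, then an
identity of associators in `A` with coefficients `c * ε` yields one in `A ⊗ B` with
coefficients `c`. -/
theorem sum_smul_assoc_tensor_eq_zero {K A B : Type*} [Field K]
    [AddCommGroup A] [Module K A] [AddCommGroup B] [Module K B]
    {μA : A →ₗ[K] A →ₗ[K] A} {μB : B →ₗ[K] B →ₗ[K] B}
    {μT : A ⊗[K] B →ₗ[K] A ⊗[K] B →ₗ[K] A ⊗[K] B}
    (hμT : ∀ (a₁ a₂ : A) (b₁ b₂ : B),
      μT (a₁ ⊗ₜ[K] b₁) (a₂ ⊗ₜ[K] b₂) = (μA a₁ a₂) ⊗ₜ[K] (μB b₁ b₂))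
    (c ε : S3 → K)
    (hA : ∀ x : Fin 3 → A, ∑ σ : S3, (c σ * ε σ) • assoc μA (x (σ 0)) (x (σ 1)) (x (σ 2)) = 0)
    (hB : ∀ x y z : B, μB (μB x y) z = μB x (μB y z))
    (hε : ∀ (σ : S3) (x : Fin 3 → B),
      μB (μB (x (σ 0)) (x (σ 1))) (x (σ 2)) = ε σ • μB (μB (x 0) (x 1)) (x 2))
    (x : Fin 3 → A ⊗[K] B) :
    ∑ σ : S3, c σ • assoc μT (x (σ 0)) (x (σ 1)) (x (σ 2)) = 0 := by
  have key := MultilinearMap.eq_zero_of_forall_tmul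
    (∑ σ : S3, c σ • (assocMultilinear μT).domDomCongr σ) ?_ x
  · simpa [sum_apply, assocMultilinear] using key
  · intro a b
    have hterm (σ : S3) :
        c σ • assoc μT (a (σ 0) ⊗ₜ[K] b (σ 0)) (a (σ 1) ⊗ₜ[K] b (σ 1)) (a (σ 2) ⊗ₜ[K] b (σ 2)) =
          ((c σ * ε σ) • assoc μA (a (σ 0)) (a (σ 1)) (a (σ 2))) ⊗ₜ[K]
            μB (μB (b 0) (b 1)) (b 2) := by
      simp only [assoc, hμT]
      rw [← hB, hε, ← TensorProduct.sub_tmul, TensorProduct.tmul_smul, smul_smul,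
        TensorProduct.smul_tmul']
    have hsum := congrArg (· ⊗ₜ[K] μB (μB (b 0) (b 1)) (b 2)) (hA a)
    simp only [TensorProduct.sum_tmul, TensorProduct.zero_tmul, ← hterm] at hsum
    simpa [sum_apply, assocMultilinear] using hsum

/-- Triple products in a `W!`-algebra are alternating under permutations of the factors. -/
theorem IsWDualAlg.mul_mul_perm {K B : Type*} [Field K] [AddCommGroup B] [Module K B]
    {μ : B →ₗ[K] B →ₗ[K] B} (h : IsWDualAlg μ) (σ : S3) (x : Fin 3 → B) :
    μ (μ (x (σ 0)) (x (σ 1))) (x (σ 2)) =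
      ((Equiv.Perm.sign σ : ℤ) : K) • μ (μ (x 0) (x 1)) (x 2) := by
  obtain ⟨-, h12, h23⟩ := h
  have adj (y : Fin 3 → B) (i : Fin 2) :
      μ (μ (y (Equiv.swap i.castSucc i.succ 0)) (y (Equiv.swap i.castSucc i.succ 1)))
        (y (Equiv.swap i.castSucc i.succ 2)) = -μ (μ (y 0) (y 1)) (y 2) := by
    fin_cases i
    · exact h12 _ _ _
    · exact h23 _ _ _
  have hσ : σ ∈ Submonoid.closure (Set.range fun i : Fin 2 => Equiv.swap i.castSucc i.succ) := by
    rw [Equiv.Perm.mclosure_swap_castSucc_succ]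
    trivial
  induction hσ using Submonoid.closure_induction generalizing x with
  | mem σ hσ =>
    obtain ⟨i, rfl⟩ := hσ
    rw [adj, Equiv.Perm.sign_swap i.castSucc_lt_succ.ne]
    simp
  | one => simp
  | mul σ τ _ _ ihσ ihτ =>
    have := ihτ (x ∘ σ)
    simp only [Function.comp_apply] at this
    simp only [Equiv.Perm.mul_apply, this, ihσ, map_mul, Units.val_mul, Int.cast_mul, smul_smul,
      mul_comm]

theorem stmt19 (K : Type*) [Field K] [CharZero K]
    (A B : Type*) [AddCommGroup A] [Module K A] [AddCommGroup B] [Module K B]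
    (μA : A →ₗ[K] A →ₗ[K] A) (μB : B →ₗ[K] B →ₗ[K] B)
    (μT : TensorProduct K A B →ₗ[K] TensorProduct K A B →ₗ[K] TensorProduct K A B)
    (hμT : ∀ (a₁ a₂ : A) (b₁ b₂ : B),
      μT (a₁ ⊗ₜ[K] b₁) (a₂ ⊗ₜ[K] b₂) = (μA a₁ a₂) ⊗ₜ[K] (μB b₁ b₂)) :
    (IsVAlg μA → IsWDualAlg μB → IsWAlg μT) ∧
    (IsWAlg μA → IsVDualAlg μB → IsWAlg μT) ∧
    (IsWAlg μA → IsWDualAlg μB → IsVAlg μT) := by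
  refine ⟨fun hA hB => ?_, fun hA hB => ?_, fun hA hB => ?_⟩
  · intro x
    simpa using sum_smul_assoc_tensor_eq_zero hμT (fun _ => 1) _
      (by simpa [IsVAlg] using hA) hB.1 hB.mul_mul_perm x
  · intro x
    simpa using sum_smul_assoc_tensor_eq_zero hμT (fun _ => 1) (fun _ => 1)
      (by simpa [IsWAlg] using hA) hB.1 (fun σ y => by rw [one_smul, ← hB.2]) x
  · refine sum_smul_assoc_tensor_eq_zero hμT _ _ (fun x => ?_) hB.1 hB.mul_mul_perm
    have hsq (σ : S3) :
        ((Equiv.Perm.sign σ : ℤ) : K) * ((Equiv.Perm.sign σ : ℤ) : K) = 1 := by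
      rw [← Int.cast_mul, Int.units_coe_mul_self, Int.cast_one]
    simpa [hsq] using hA x
end
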